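/- arXiv:2409.02765 — 2 statements merged into one kernel-verified Lean document; each statement's English description precedes it below -/
import Mathlib

section
/- Let ε > 0 and let n be an integer with εn ≥ 3. Let H be a 3-uniform hypergraph on n vertices with δ₂(H) ≥ (1/3 + ε)n containing no homomorphic copy of the tight cycle C₁₁. Then there exists a vertex v* of H with d_B(v*) > 0, d_D⁺(v*) > 0, and d_D⁻(v*) > 0, where d_B denotes degree in the base-pair graph B and d_D⁺, d_D⁻ denote out- and in-degree in the apex digraph D. -/
open Finset

/-- A 3-uniform hypergraph given by its edge set: every edge has exactly 3 vertices. -/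
def IsUniform3 {V : Type*} (H : Finset (Finset V)) : Prop :=
  ∀ e ∈ H, e.card = 3

/-- The codegree of a pair of vertices: the number of vertices `w` with `{u,v,w} ∈ H`. -/
noncomputable def codeg {V : Type*} [DecidableEq V] (H : Finset (Finset V)) (u v : V) : ℕ :=
  {w : V | ({u, v, w} : Finset V) ∈ H}.ncard

/-- The minimum codegree `δ₂(H)`: the minimum of `codeg H u v` over pairs of distinct vertices. -/
noncomputable def minCodeg {V : Type*} [DecidableEq V] (H : Finset (Finset V)) : ℕ :=
  sInf {d : ℕ | ∃ u v : V, u ≠ v ∧ codeg H u v = d}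

/-- `H` contains a homomorphic copy of the tight cycle `C_ℓ`: a cyclic sequence of vertices
(indexed by `ZMod ℓ`, not necessarily distinct) in which every three cyclically consecutive
vertices are pairwise distinct and form an edge of `H`. -/
def HasHomTightCycle {V : Type*} [DecidableEq V] (ℓ : ℕ) (H : Finset (Finset V)) : Prop :=
  ∃ x : ZMod ℓ → V, ∀ i : ZMod ℓ,
    x (i - 1) ≠ x i ∧ x i ≠ x (i + 1) ∧ x (i - 1) ≠ x (i + 1) ∧
      ({x (i - 1), x i, x (i + 1)} : Finset V) ∈ H

/-- `H` contains a (genuine) copy of the tight cycle `C_ℓ`: `ℓ` distinct vertices, cyclically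
ordered, such that every three cyclically consecutive vertices form an edge of `H`. -/
def HasTightCycle {V : Type*} [DecidableEq V] (ℓ : ℕ) (H : Finset (Finset V)) : Prop :=
  ∃ x : ZMod ℓ → V, Function.Injective x ∧
    ∀ i : ZMod ℓ, ({x (i - 1), x i, x (i + 1)} : Finset V) ∈ H

/-- The arc `u → v` of the apex digraph `D`: some `K₄⁻` of `H` contains `u` and `v`
with apex `v`; i.e. there are two further vertices `a, b` (with `u,v,a,b` distinct)
such that the three edges through `v` on `{u,v,a,b}` all lie in `H`. -/
def ArcD {V : Type*} [DecidableEq V] (H : Finset (Finset V)) (u v : V) : Prop :=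
  ∃ a b : V, ({u, v, a, b} : Finset V).card = 4 ∧
    ({v, u, a} : Finset V) ∈ H ∧ ({v, u, b} : Finset V) ∈ H ∧ ({v, a, b} : Finset V) ∈ H

/-- `{u,v}` is a base pair: some `K₄⁻` of `H` contains `u` and `v` with neither `u` nor
`v` being the apex; i.e. there are further vertices `w, a` (with `u,v,w,a` distinct) with
apex `w`, so that the three edges through `w` on `{u,v,w,a}` all lie in `H`. -/
def BasePair {V : Type*} [DecidableEq V] (H : Finset (Finset V)) (u v : V) : Prop :=
  ∃ w a : V, ({u, v, w, a} : Finset V).card = 4 ∧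
    ({w, u, v} : Finset V) ∈ H ∧ ({w, u, a} : Finset V) ∈ H ∧ ({w, v, a} : Finset V) ∈ H

/-- The degree of `v` in the base-pair graph `B`. -/
noncomputable def degB {V : Type*} [DecidableEq V] (H : Finset (Finset V)) (v : V) : ℕ :=
  {u : V | BasePair H u v}.ncard

/-- The out-degree of `v` in the apex digraph `D`. -/
noncomputable def outDegD {V : Type*} [DecidableEq V] (H : Finset (Finset V)) (v : V) : ℕ :=
  {u : V | ArcD H v u}.ncard

/-- The in-degree of `v` in the apex digraph `D`. -/
noncomputable def inDegD {V : Type*} [DecidableEq V] (H : Finset (Finset V)) (v : V) : ℕ :=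
  {u : V | ArcD H u v}.ncard

/-- The codegree Turán number `ex₂(n, C_ℓ)`: the maximum of `δ₂(H)` over all 3-uniform
hypergraphs `H` on `n` vertices containing no copy of the tight cycle `C_ℓ`. -/
noncomputable def exCodeg (ℓ n : ℕ) : ℕ :=
  sSup {k : ℕ | ∃ H : Finset (Finset (Fin n)),
    IsUniform3 H ∧ ¬ HasTightCycle ℓ H ∧ minCodeg H = k}

section Helpers

variable {V : Type*} [DecidableEq V]

theorem IsUniform3.distinct {H : Finset (Finset V)} (hH : IsUniform3 H) {x y z : V}
    (h : ({x, y, z} : Finset V) ∈ H) : x ≠ y ∧ x ≠ z ∧ y ≠ z := by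
  have h3 := hH _ h
  refine ⟨?_, ?_, ?_⟩ <;> rintro rfl
  · rw [insert_idem] at h3
    have := card_le_two (a := x) (b := z)
    omega
  · rw [Finset.insert_comm, Finset.pair_eq_singleton] at h3
    have := card_le_two (a := y) (b := x)
    omega
  · rw [Finset.pair_eq_singleton] at h3
    have := card_le_two (a := x) (b := y)
    omega

theorem minCodeg_le_codeg (H : Finset (Finset V)) {u v : V} (h : u ≠ v) :
    minCodeg H ≤ codeg H u v :=
  Nat.sInf_le ⟨u, v, h, rfl⟩

theorem ArcD.basePair {H : Finset (Finset V)} {u v : V} (h : ArcD H u v) :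
    ∃ a, BasePair H a u := by
  obtain ⟨a, b, hc, h1, h2, h3⟩ := h
  refine ⟨a, v, b, ?_, ?_, h3, h2⟩
  · rw [← hc]
    congr 1
    ext t
    simp only [mem_insert, mem_singleton]
    tauto
  · rwa [Finset.pair_comm a u]

/-- The edges `xyz`, `xyw`, `zyw` form a `K₄⁻` with apex `y`, so `x` and `z` send arcs to `y`. -/
theorem arcD_of_edges {H : Finset (Finset V)} (hH : IsUniform3 H) {x y z w : V}
    (hz : ({x, y, z} : Finset V) ∈ H) (hxw : ({x, y, w} : Finset V) ∈ H)
    (hzw : ({z, y, w} : Finset V) ∈ H) : ArcD H x y ∧ ArcD H z y := by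
  obtain ⟨hxy, hxz, hyz⟩ := hH.distinct hz
  obtain ⟨-, hxw', hyw⟩ := hH.distinct hxw
  obtain ⟨-, hzw', -⟩ := hH.distinct hzw
  have e1 : ({y, x, z} : Finset V) ∈ H := by rwa [Finset.insert_comm]
  have e2 : ({y, x, w} : Finset V) ∈ H := by rwa [Finset.insert_comm]
  have e3 : ({y, z, w} : Finset V) ∈ H := by rwa [Finset.insert_comm]
  refine ⟨⟨z, w, ?_, e1, e2, e3⟩, ⟨x, w, ?_, ?_, e3, e2⟩⟩
  · exact card_eq_four.2 ⟨x, y, z, w, hxy, hxz, hxw', hyz, hyw, hzw', rfl⟩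
  · exact card_eq_four.2 ⟨z, y, x, w, hyz.symm, hxz.symm, hzw', hxy.symm, hyw, hxw', rfl⟩
  · rwa [Finset.pair_comm z x]

/-- If every codegree exceeds a third of the number of vertices, every edge lies in a `K₄⁻` whose
apex belongs to that edge. -/
theorem exists_apex_of_edge [Fintype V] {H : Finset (Finset V)} (hH : IsUniform3 H)
    (hd : Fintype.card V < 3 * minCodeg H) {x y z : V} (h : ({x, y, z} : Finset V) ∈ H) :
    (ArcD H y x ∧ ArcD H z x) ∨ (ArcD H x y ∧ ArcD H z y) ∨ (ArcD H x z ∧ ArcD H y z) := by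
  classical
  obtain ⟨hxy, hxz, hyz⟩ := hH.distinct h
  let N (u v : V) : Finset V := {w | ({u, v, w} : Finset V) ∈ H}
  have hN {u v : V} (huv : u ≠ v) : minCodeg H ≤ #(N u v) := by
    refine (minCodeg_le_codeg H huv).trans (le_of_eq ?_)
    rw [codeg, ← Set.ncard_coe_finset]
    simp [N]
  have mem {u v w : V} (hw : w ∈ N u v) : ({u, v, w} : Finset V) ∈ H := by simpa [N] using hw
  have swap {u v w : V} (hw : ({u, v, w} : Finset V) ∈ H) : ({v, u, w} : Finset V) ∈ H := by
    rwa [Finset.insert_comm]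
  have rot {u v w : V} (hw : ({u, v, w} : Finset V) ∈ H) : ({u, w, v} : Finset V) ∈ H := by
    rwa [Finset.pair_comm]
  by_cases d1 : Disjoint (N x y) (N x z)
  · by_cases d2 : Disjoint (N x y ∪ N x z) (N y z)
    · have := card_le_univ ((N x y ∪ N x z) ∪ N y z)
      rw [card_union_of_disjoint d2, card_union_of_disjoint d1] at this
      have := hN hxy
      have := hN hxz
      have := hN hyz
      omega
    · obtain ⟨w, hw, hw'⟩ := not_disjoint_iff.1 d2
      rcases mem_union.1 hw with hw | hw
      · exact .inr (.inl (arcD_of_edges hH h (mem hw) (swap (mem hw'))))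
      · exact .inr (.inr (arcD_of_edges hH (rot h) (mem hw) (mem hw')))
  · obtain ⟨w, hw, hw'⟩ := not_disjoint_iff.1 d1
    exact .inl (arcD_of_edges hH (swap h) (swap (mem hw)) (swap (mem hw')))

/-- A vertex that is both the apex of some `K₄⁻` and a base vertex of another one. Otherwise every
edge would contain exactly one apex, so two edges on a common pair of base vertices would give a
pair of apexes lying in no edge. -/
theorem exists_vertex_arcs [Fintype V] {H : Finset (Finset V)} (hH : IsUniform3 H)
    (hV : 1 < Fintype.card V) (hd : Fintype.card V < 3 * minCodeg H) (h2 : 2 ≤ minCodeg H) :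
    ∃ v, (∃ u, ArcD H v u) ∧ ∃ u, ArcD H u v := by
  by_contra! hno
  have exists_edge {u v : V} (huv : u ≠ v) (t : V) : ∃ w ≠ t, ({u, v, w} : Finset V) ∈ H := by
    have : 1 < codeg H u v := h2.trans (minCodeg_le_codeg H huv)
    obtain ⟨w, hw, hwt⟩ := Set.exists_ne_of_one_lt_ncard this t
    exact ⟨w, hwt, hw⟩
  have no_common_apex {x y z : V} (hyx : ArcD H y x) (hzx : ArcD H z x) (hyz : y ≠ z) : False := by
    obtain ⟨w, hwx, hw⟩ := exists_edge hyz x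
    have hyw : ArcD H y w := by
      rcases exists_apex_of_edge hH hd hw with h | h | h
      · exact (hno y ⟨_, hyx⟩ _ h.1).elim
      · exact (hno z ⟨_, hzx⟩ _ h.1).elim
      · exact h.1
    obtain ⟨t, -, ht⟩ := exists_edge hwx.symm x
    rcases exists_apex_of_edge hH hd ht with h | h | h
    · exact hno w ⟨_, h.1⟩ _ hyw
    · exact hno x ⟨_, h.1⟩ _ hyx
    · exact hno x ⟨_, h.1⟩ _ hyx
  obtain ⟨x, y, hxy⟩ := Fintype.one_lt_card_iff.1 hV
  obtain ⟨z, -, hz⟩ := exists_edge hxy x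
  obtain ⟨-, hxz, hyz⟩ := hH.distinct hz
  rcases exists_apex_of_edge hH hd hz with h | h | h
  · exact no_common_apex h.1 h.2 hyz
  · exact no_common_apex h.1 h.2 hxz
  · exact no_common_apex h.1 h.2 hxy

end Helpers

/-- If `ε > 0`, `εn ≥ 3` and `H` is a 3-uniform hypergraph on `n` vertices with
`δ₂(H) ≥ (1/3 + ε)n` and no homomorphic copy of `C₁₁`, then there is a vertex `v*` with
`d_B(v*) > 0`, `d_D⁺(v*) > 0` and `d_D⁻(v*) > 0`. -/
theorem exists_vertex_all_degrees_pos {n : ℕ} (ε : ℝ) (hε : 0 < ε) (hεn : (3 : ℝ) ≤ ε * n)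
    (H : Finset (Finset (Fin n))) (hH : IsUniform3 H)
    (hδ : ((1 / 3 : ℝ) + ε) * n ≤ (minCodeg H : ℝ))
    (hfree : ¬ HasHomTightCycle 11 H) :
    ∃ v : Fin n, 0 < degB H v ∧ 0 < outDegD H v ∧ 0 < inDegD H v := by
  have hpos : 0 < minCodeg H := by
    have : (0 : ℝ) < minCodeg H := by linarith [n.cast_nonneg (α := ℝ)]
    exact_mod_cast this
  have hd : n < 3 * minCodeg H := by
    have : (n : ℝ) < 3 * minCodeg H := by linarith
    exact_mod_cast this
  have h2 : 2 ≤ minCodeg H := by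
    have : (2 : ℝ) ≤ minCodeg H := by linarith [n.cast_nonneg (α := ℝ)]
    exact_mod_cast this
  have hn : 1 < n := by
    obtain ⟨-, u, v, huv, -⟩ := Nat.nonempty_of_pos_sInf hpos
    omega
  obtain ⟨v, ⟨u, hvu⟩, w, hwv⟩ :=
    exists_vertex_arcs hH (by simpa using hn) (by simpa using hd) h2
  obtain ⟨a, ha⟩ := hvu.basePair
  exact ⟨v, (Set.ncard_pos (Set.toFinite _)).2 ⟨a, ha⟩,
    (Set.ncard_pos (Set.toFinite _)).2 ⟨u, hvu⟩, (Set.ncard_pos (Set.toFinite _)).2 ⟨w, hwv⟩⟩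
end

section
/- For every ℓ with ℓ ∈ {10, 13, 16} or (ℓ ≥ 19 and ℓ not divisible by 3), the sequence ex₂(n, C_ℓ)/n converges to 1/3 as n → ∞; that is, the codegree Turán density of the 3-uniform tight cycle C_ℓ equals 1/3. -/
open Finset

open scoped Classical in
/-- The number of elements of a finite type satisfying a predicate, as a real number. -/
noncomputable def cnt {α : Type*} [Fintype α] (P : α → Prop) : ℝ :=
  ((univ.filter P).card : ℝ)

section Counting

variable {α β : Type*} [Fintype α] [Fintype β]

lemma cnt_nonneg (P : α → Prop) : 0 ≤ cnt P := Nat.cast_nonneg _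

lemma cnt_mono {P Q : α → Prop} (h : ∀ x, P x → Q x) : cnt P ≤ cnt Q := by
  classical
  unfold cnt
  exact_mod_cast card_le_card (monotone_filter_right _ (fun x _ hx => h x hx))

open scoped Classical in
lemma cnt_eq_sum (P : α → Prop) : cnt P = ∑ x, if P x then (1 : ℝ) else 0 := by
  simp [cnt]

lemma cnt_or_le (P Q : α → Prop) : cnt (fun x => P x ∨ Q x) ≤ cnt P + cnt Q := by
  classical
  simp only [cnt_eq_sum, ← sum_add_distrib]
  refine sum_le_sum fun x _ => ?_
  by_cases hP : P x <;> by_cases hQ : Q x <;> simp [hP, hQ]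

lemma exists_of_cnt_lt {P Q : α → Prop} (h : cnt Q < cnt P) : ∃ x, P x ∧ ¬ Q x := by
  by_contra! hc
  exact absurd (cnt_mono hc) (not_le.2 h)

lemma cnt_le_of_injective {P : α → Prop} {Q : β → Prop} (f : α → β) (hf : Function.Injective f)
    (h : ∀ x, P x → Q (f x)) : cnt P ≤ cnt Q := by
  classical
  unfold cnt
  exact_mod_cast card_le_card_of_injOn f (fun x hx => by simpa using h x (by simpa using hx))
    hf.injOn

lemma cnt_congr_equiv {P : α → Prop} {Q : β → Prop} (f : α ≃ β)
    (h : ∀ x, P x ↔ Q (f x)) : cnt P = cnt Q :=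
  le_antisymm (cnt_le_of_injective f f.injective fun x hx => (h x).1 hx)
    (cnt_le_of_injective f.symm f.symm.injective fun x hx => (h _).2 (by simpa using hx))

lemma cnt_prod (R : α → β → Prop) :
    cnt (fun p : α × β => R p.1 p.2) = ∑ x, cnt (R x) := by
  classical
  simp only [cnt_eq_sum, Fintype.sum_prod_type]

lemma cnt_prod_le (R : α → β → Prop) {t : ℝ} (h : ∀ x, cnt (R x) ≤ t) :
    cnt (fun p : α × β => R p.1 p.2) ≤ Fintype.card α * t := by
  rw [cnt_prod]
  refine (sum_le_sum fun x _ => h x).trans ?_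
  simp

/-- Markov's inequality for counting. -/
lemma cnt_mul_le_cnt_prod (R : α → β → Prop) {Q : α → Prop} {t : ℝ}
    (h : ∀ x, Q x → t ≤ cnt (R x)) :
    cnt Q * t ≤ cnt (fun p : α × β => R p.1 p.2) := by
  classical
  rw [cnt_prod, cnt_eq_sum, sum_mul]
  refine sum_le_sum fun x _ => ?_
  by_cases hQ : Q x
  · simpa [hQ] using h x hQ
  · simpa [hQ] using cnt_nonneg _

lemma cnt_and_mul (P : α → Prop) (Q : β → Prop) :
    cnt (fun p : α × β => P p.1 ∧ Q p.2) = cnt P * cnt Q := by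
  classical
  simp only [cnt_eq_sum, Fintype.sum_prod_type, sum_mul_sum]
  refine sum_congr rfl fun x _ => sum_congr rfl fun y _ => ?_
  by_cases hP : P x <;> by_cases hQ : Q y <;> simp [hP, hQ]

lemma cnt_forall_pi (t : ℕ) (P : α → Prop) :
    cnt (fun f : Fin t → α => ∀ i, P (f i)) = cnt P ^ t := by
  classical
  unfold cnt
  rw [← Nat.cast_pow]
  congr 1
  trans (Fintype.piFinset (fun _ : Fin t => univ.filter P)).card
  · congr 1
    ext
    simp
  · simp

/-- Jensen's inequality: cloning one coordinate `t` times. -/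
lemma cnt_clone (t : ℕ) {c : ℝ} (hc : 0 ≤ c) (R : α → β → Prop)
    (h : c * (Fintype.card α * Fintype.card β) ≤ cnt (fun p : α × β => R p.1 p.2)) :
    c ^ t * (Fintype.card α ^ t * Fintype.card β) ≤
      cnt (fun p : (Fin t → α) × β => ∀ i, R (p.1 i) p.2) := by
  have h1 : cnt (fun p : (Fin t → α) × β => ∀ i, R (p.1 i) p.2)
      = ∑ y, cnt (fun x => R x y) ^ t := by
    rw [← cnt_congr_equiv (Equiv.prodComm β (Fin t → α))
      (P := fun p : β × (Fin t → α) => ∀ i, R (p.2 i) p.1) (by simp),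
        cnt_prod (fun y (f : Fin t → α) => ∀ i, R (f i) y)]
    exact sum_congr rfl fun y _ => cnt_forall_pi t (fun x => R x y)
  have h2 : cnt (fun p : α × β => R p.1 p.2) = ∑ y, cnt (fun x => R x y) := by
    rw [← cnt_congr_equiv (Equiv.prodComm β α)
      (P := fun p : β × α => R p.2 p.1) (by simp), cnt_prod (fun y x => R x y)]
  rw [h1]
  rw [h2] at h
  rcases t with _ | t
  · simp
  rcases isEmpty_or_nonempty β with hβ | hβ
  · simp
  have hβ' : (0 : ℝ) < Fintype.card β := by exact_mod_cast Fintype.card_pos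
  have h3 := pow_sum_div_card_le_sum_pow (s := univ) (f := fun y => cnt (fun x => R x y)) (n := t)
    (fun y _ => cnt_nonneg _)
  refine le_trans ?_ h3
  rw [le_div_iff₀ (by simpa using pow_pos hβ' t)]
  refine le_trans (le_of_eq ?_) (pow_le_pow_left₀ (by positivity) h (t + 1))
  simp only [card_univ]
  ring

end Counting

lemma cnt_blowup {V : Type} [Fintype V] (t k : ℕ) : ∀ (W : Type) [Fintype W]
    (A : (Fin k → V) → W → Prop) {c : ℝ}, 0 ≤ c →
    c * (Fintype.card V ^ k * Fintype.card W) ≤ cnt (fun p : (Fin k → V) × W => A p.1 p.2) →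
    c ^ (t ^ k) * (Fintype.card V ^ (k * t) * Fintype.card W) ≤
      cnt (fun p : (Fin k → Fin t → V) × W =>
        ∀ σ : Fin k → Fin t, A (fun i => p.1 i (σ i)) p.2) := by
  induction k with
  | zero =>
    intro W _ A c hc h
    refine le_trans ?_ (h.trans (le_of_eq ?_))
    · simp
    · refine cnt_congr_equiv (Equiv.prodCongr (Equiv.ofUnique _ _) (Equiv.refl W)) fun x => ?_
      simp only [Equiv.prodCongr_apply, Prod.map]
      have hz : ∀ z z' : Fin 0 → V, A z x.2 ↔ A z' x.2 := fun z z' => by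
        rw [Subsingleton.elim z z']
      exact ⟨fun hx _ => (hz _ _).1 hx, fun hx => (hz _ _).1 (hx (fun i => i.elim0))⟩
  | succ k ih =>
    intro W _ A c hc h
    have h1 : cnt (fun p : (Fin (k + 1) → V) × W => A p.1 p.2)
        = cnt (fun p : V × ((Fin k → V) × W) => A (Fin.cons p.1 p.2.1) p.2.2) := by
      refine (cnt_congr_equiv ((Equiv.prodAssoc _ _ _).symm.trans
        (Equiv.prodCongr (Fin.consEquiv (fun _ => V)) (Equiv.refl W))) fun x => ?_).symm
      rfl
    rw [h1] at h
    have h2 := cnt_clone t hc (fun (v : V) (q : (Fin k → V) × W) => A (Fin.cons v q.1) q.2)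
      (by simp only [Fintype.card_prod, Fintype.card_fun, Fintype.card_fin, Nat.cast_mul,
            Nat.cast_pow] at h ⊢
          refine le_trans (le_of_eq ?_) h
          ring)
    have h3 := ih ((Fin t → V) × W) (fun z q => ∀ i, A (Fin.cons (q.1 i) z) q.2)
      (c := c ^ t) (by positivity) (by
        refine le_trans (le_of_eq ?_) (h2.trans (le_of_eq ?_))
        · simp only [Fintype.card_prod, Fintype.card_fun, Fintype.card_fin, Nat.cast_mul,
            Nat.cast_pow]
          ring
        · refine cnt_congr_equiv ((Equiv.prodAssoc _ _ _).symm.trans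
            ((Equiv.prodCongr (Equiv.prodComm _ _) (Equiv.refl W)).trans
              (Equiv.prodAssoc _ _ _))) fun x => ?_
          rfl)
    refine le_trans (le_of_eq ?_) (h3.trans (cnt_le_of_injective
      (fun p => (Fin.cons p.2.1 p.1, p.2.2)) ?_ ?_))
    · simp only [Fintype.card_prod, Fintype.card_fun, Fintype.card_fin, Nat.cast_mul,
            Nat.cast_pow]
      ring
    · rintro ⟨a, b, w⟩ ⟨a', b', w'⟩ hh
      simp only [Prod.mk.injEq, Fin.cons_inj] at hh
      simp [hh]
    · rintro ⟨a, b, w⟩ hh σ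
      have := hh (fun i => σ i.succ) (σ 0)
      convert this using 1
      ext i
      refine Fin.cases ?_ (fun j => ?_) i <;> simp

lemma cnt_not_injective {ι V : Type*} [Fintype ι] [DecidableEq ι] [Fintype V] :
    Fintype.card V * cnt (fun f : ι → V => ¬ Function.Injective f) ≤
      Fintype.card ι ^ 2 * (Fintype.card V : ℝ) ^ Fintype.card ι := by
  classical
  have key : ∀ i j : ι, i ≠ j →
      Fintype.card V * cnt (fun f : ι → V => f i = f j) ≤
        (Fintype.card V : ℝ) ^ Fintype.card ι := by
    intro i j hij
    have h1 : cnt (fun p : V × (ι → V) => True ∧ p.2 i = p.2 j)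
        ≤ cnt (fun _ : ι → V => True) := by
      unfold cnt
      norm_cast
      refine card_le_card_of_injOn (fun p => Function.update p.2 i p.1) (by simp) ?_
      rintro ⟨x, f⟩ hf ⟨y, g⟩ hg h
      simp only [coe_filter, mem_univ, true_and, Set.mem_ofPred_eq] at hf hg h
      have hx : x = y := by simpa using congrFun h i
      have hfg : ∀ l, l ≠ i → f l = g l := fun l hl => by
        simpa [Function.update_of_ne hl] using congrFun h l
      refine Prod.ext hx (funext fun l => ?_)
      by_cases hl : l = i
      · subst hl
        simp only
        rw [hf, hg, hfg j hij.symm]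
      · exact hfg l hl
    rw [cnt_and_mul (fun _ : V => True) (fun f : ι → V => f i = f j)] at h1
    simpa [cnt] using h1
  have h2 : cnt (fun f : ι → V => ¬ Function.Injective f) ≤
      ∑ p : ι × ι, if p.1 ≠ p.2 then cnt (fun f : ι → V => f p.1 = f p.2) else 0 := by
    have : ∀ p : ι × ι, (if p.1 ≠ p.2 then cnt (fun f : ι → V => f p.1 = f p.2) else 0)
      = ∑ f : ι → V, if p.1 ≠ p.2 ∧ f p.1 = f p.2 then (1 : ℝ) else 0 := by
      intro p
      by_cases hp : p.1 ≠ p.2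
      · simp [hp, cnt_eq_sum]
      · simp [hp]
    simp_rw [this]
    rw [sum_comm, cnt_eq_sum]
    refine sum_le_sum fun f _ => ?_
    by_cases hf : Function.Injective f
    · rw [if_neg (not_not.2 hf)]
      exact sum_nonneg fun p _ => by split_ifs <;> norm_num
    · rw [if_pos hf]
      obtain ⟨a, b, hab, hne⟩ := Function.not_injective_iff.1 hf
      refine le_trans ?_ (single_le_sum (f := fun p : ι × ι =>
        if p.1 ≠ p.2 ∧ f p.1 = f p.2 then (1 : ℝ) else 0) (fun p _ => by split_ifs <;> norm_num)
        (mem_univ (a, b)))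
      simp [hne, hab]
  refine (mul_le_mul_of_nonneg_left h2 (Nat.cast_nonneg _)).trans ?_
  rw [mul_sum]
  refine (sum_le_sum (g := fun _ => (Fintype.card V : ℝ) ^ Fintype.card ι) fun p _ => ?_).trans ?_
  · split_ifs with hp
    · exact key _ _ hp
    · rw [mul_zero]; positivity
  · simp [sq]


lemma exists_closed_walk {X : Type*} {R : X → X → X → Prop}
    (hrot : ∀ a b c, R a b c → R b c a) {s : ℕ → X} (hper : ∀ j, s (j + 10) = s j)
    (hR : ∀ j, R (s j) (s (j + 1)) (s (j + 2))) (m k : ℕ) (hm : 1 ≤ m) :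
    ∃ h : ℕ → X, ∀ i < 10 * m + 3 * k,
      R (h i) (h ((i + 1) % (10 * m + 3 * k))) (h ((i + 2) % (10 * m + 3 * k))) := by
  have hmod : ∀ j, s (j % 10) = s j := fun j => Function.Periodic.map_mod_nat hper j
  refine ⟨fun i => if i < 3 * k then s (i % 3) else s (i - 3 * k), fun i hi => ?_⟩
  have hstart : ∀ j, j ≤ 3 * k + 1 → (if j < 3 * k then s (j % 3) else s (j - 3 * k))
      = s (j % 3) := by
    intro j hj
    split_ifs with h
    · rfl
    · congr 1
      omega
  have hend : ∀ j, 3 * k ≤ j → j ≤ 10 * m + 3 * k + 1 →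
      (if j % (10 * m + 3 * k) < 3 * k then s (j % (10 * m + 3 * k) % 3)
        else s (j % (10 * m + 3 * k) - 3 * k)) = s (j - 3 * k) := by
    intro j h1 h2
    rcases lt_or_ge j (10 * m + 3 * k) with h3 | h3
    · rw [Nat.mod_eq_of_lt h3, if_neg (by omega)]
    · have h4 : j % (10 * m + 3 * k) = j - (10 * m + 3 * k) := by
        rw [Nat.mod_eq_sub_mod h3, Nat.mod_eq_of_lt (by omega)]
      rw [h4, hstart _ (by omega), ← hmod (j - 3 * k)]
      congr 1
      omega
  rcases lt_or_ge i (3 * k) with h | h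
  · simp only
    rw [Nat.mod_eq_of_lt (by omega : i + 1 < 10 * m + 3 * k),
      Nat.mod_eq_of_lt (by omega : i + 2 < 10 * m + 3 * k),
      hstart i (by omega), hstart (i + 1) (by omega), hstart (i + 2) (by omega)]
    have h0 : R (s 0) (s 1) (s 2) := hR 0
    have hi3 : i % 3 < 3 := Nat.mod_lt _ (by norm_num)
    rw [Nat.add_mod i 1, Nat.add_mod i 2]
    interval_cases i % 3
    · exact h0
    · exact hrot _ _ _ h0
    · exact hrot _ _ _ (hrot _ _ _ h0)
  · have h1 := hend i h (by omega)
    rw [Nat.mod_eq_of_lt hi] at h1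
    simp only
    rw [h1, hend (i + 1) (by omega) (by omega), hend (i + 2) (by omega) (by omega)]
    have := hR (i - 3 * k)
    rwa [show i - 3 * k + 1 = i + 1 - 3 * k by omega,
      show i - 3 * k + 2 = i + 2 - 3 * k by omega] at this

lemma exists_injective_closed_walk {V : Type} [Fintype V] {E : V → V → V → Prop}
    (hrot : ∀ a b c, E a b c → E b c a) {k : ℕ} {s : ℕ → Fin k} (hper : ∀ j, s (j + 10) = s j)
    (hs : ∀ j, s j ≠ s (j + 1) ∧ s (j + 1) ≠ s (j + 2) ∧ s j ≠ s (j + 2))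
    (m q : ℕ) (hm : 1 ≤ m) {c : ℝ} (hc : 0 < c)
    (hcount : c * (Fintype.card V : ℝ) ^ k ≤
      cnt (fun z : Fin k → V => ∀ j, E (z (s j)) (z (s (j + 1))) (z (s (j + 2)))))
    (hbig : ((k * (10 * m + 3 * q) : ℕ) : ℝ) ^ 2 <
      c ^ ((10 * m + 3 * q) ^ k) * Fintype.card V) :
    ∃ y : ℕ → V, Set.InjOn y (Set.Iio (10 * m + 3 * q)) ∧ ∀ i < 10 * m + 3 * q,
      E (y i) (y ((i + 1) % (10 * m + 3 * q))) (y ((i + 2) % (10 * m + 3 * q))) := by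
  set P : (Fin k → V) → Prop :=
    fun z => ∀ j, E (z (s j)) (z (s (j + 1))) (z (s (j + 2)))
  obtain ⟨h, hh⟩ := exists_closed_walk
    (R := fun a b d : Fin k => (a ≠ b ∧ b ≠ d ∧ a ≠ d) ∧ ∀ z, P z → E (z a) (z b) (z d))
    (fun a b d hR => ⟨⟨hR.1.2.1, hR.1.2.2.symm, hR.1.1.symm⟩, fun z hz => hrot _ _ _ (hR.2 z hz)⟩)
    hper (fun j => ⟨hs j, fun z hz => hz j⟩) m q hm
  clear_value P
  set ℓ := 10 * m + 3 * q with hℓ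
  have hℓ0 : 0 < ℓ := by omega
  have hn : (0 : ℝ) < Fintype.card V := by
    by_contra hn
    have : (Fintype.card V : ℝ) = 0 := le_antisymm (not_lt.1 hn) (Nat.cast_nonneg _)
    rw [this, mul_zero] at hbig
    exact absurd hbig (not_lt.2 (by positivity))
  have h1 := cnt_blowup ℓ k Unit (fun (z : Fin k → V) _ => P z) hc.le (by
    refine le_trans (le_of_eq ?_) (hcount.trans (cnt_le_of_injective (fun z => (z, ())) ?_ ?_))
    · simp
    · intro a b hab
      simpa using hab
    · exact fun _ hx => hx)
  have h2 : cnt (fun p : (Fin k → Fin ℓ → V) × Unit =>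
        ∀ σ : Fin k → Fin ℓ, P (fun i => p.1 i (σ i))) ≤
      cnt (fun f : Fin k × Fin ℓ → V => ∀ σ : Fin k → Fin ℓ, P (fun i => f (i, σ i))) := by
    refine cnt_le_of_injective (fun p x => p.1 x.1 x.2) ?_ ?_
    · rintro ⟨a, _⟩ ⟨b, _⟩ hab
      simp only [Prod.mk.injEq, and_true]
      funext i j
      exact congrFun hab (i, j)
    · exact fun _ hx => hx
  have h3 := cnt_not_injective (ι := Fin k × Fin ℓ) (V := V)
  simp only [Fintype.card_prod, Fintype.card_fin, Fintype.card_unit, Nat.cast_one, mul_one] at h1 h3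
  obtain ⟨f, hf, hinj⟩ := exists_of_cnt_lt
    (P := fun f : Fin k × Fin ℓ → V => ∀ σ : Fin k → Fin ℓ, P (fun i => f (i, σ i)))
    (Q := fun f => ¬ Function.Injective f) (by
      refine lt_of_lt_of_le ?_ (h1.trans h2)
      rw [← mul_lt_mul_iff_right₀ hn]
      refine h3.trans_lt ?_
      calc _ < c ^ ℓ ^ k * (Fintype.card V : ℝ) * (Fintype.card V : ℝ) ^ (k * ℓ) :=
            mul_lt_mul_of_pos_right hbig (by positivity)
        _ = _ := by ring)
  rw [not_not] at hinj
  refine ⟨fun i => f (h i, ⟨i % ℓ, Nat.mod_lt _ hℓ0⟩), ?_, fun i hi => ?_⟩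
  · intro i hi j hj hij
    have := congrArg (fun p => (p.2 : ℕ)) (hinj hij)
    simpa [Nat.mod_eq_of_lt hi, Nat.mod_eq_of_lt hj] using this
  · obtain ⟨⟨hab, hbd, had⟩, hE⟩ := hh i hi
    have hz := hf (fun v => if v = h i then ⟨i % ℓ, Nat.mod_lt _ hℓ0⟩
      else if v = h ((i + 1) % ℓ) then ⟨(i + 1) % ℓ % ℓ, Nat.mod_lt _ hℓ0⟩
      else ⟨(i + 2) % ℓ % ℓ, Nat.mod_lt _ hℓ0⟩)
    have := hE _ hz
    simpa [hab.symm, hbd.symm, had.symm] using this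

lemma false_of_nice_pairs {V : Type*} [Fintype V] [Nonempty V] {A B p : V → V → Prop} {δ : ℝ}
    (hδ : 0 < δ) (hδ' : δ ≤ 1 / 100) (hB : ∀ u v, B u v → B v u) (hp : ∀ u v, p u v → p v u)
    (hcount : cnt (fun x : V × V => ¬ p x.1 x.2) ≤ δ ^ 2 * (Fintype.card V : ℝ) ^ 2)
    (hX : ∀ u v, p u v → ¬ (A u v ∧ A v u) ∧ ¬ (A u v ∧ B u v))
    (hdeg : ∀ u v, p u v → (1 / 3 + 2 * δ) * Fintype.card V ≤
      cnt (fun w => (A u w ∧ A v w ∧ B u v) ∨ (A u v ∧ A w v ∧ B u w) ∨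
        (A v u ∧ A w u ∧ B v w))) : False := by
  set n : ℝ := (Fintype.card V : ℝ) with hn
  have hn0 : 0 < n := by rw [hn]; exact_mod_cast Fintype.card_pos
  have hδn : 0 < δ * n := by positivity
  set N : V → Prop := fun v => δ * n < cnt (fun u => ¬ p v u) with hN
  have hNc : cnt N ≤ δ * n := by
    have := cnt_mul_le_cnt_prod (fun v u => ¬ p v u) (Q := N) (t := δ * n) (fun v hv => hv.le)
    refine le_of_mul_le_mul_right (this.trans (hcount.trans (le_of_eq (by ring)))) hδn
  have hXB : ∀ u v, p u v → ¬ (A v u ∧ B u v) := fun u v huv h =>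
    (hX v u (hp _ _ huv)).2 ⟨h.1, hB _ _ h.2⟩
  have hIn : ∀ u v, p u v → A u v → (1 / 3 + 2 * δ) * n ≤ cnt (fun w => A w v) := by
    intro u v huv hA
    refine (hdeg u v huv).trans (cnt_mono fun w hw => ?_)
    rcases hw with h | h | h
    · exact absurd ⟨hA, h.2.2⟩ (hX u v huv).2
    · exact h.2.1
    · exact absurd ⟨hA, h.1⟩ (hX u v huv).1
  have hOutB : ∀ v x, p v x → A v x → (1 / 3 + 2 * δ) * n ≤ cnt (fun w => B v w) := by
    intro v x hvx hA
    refine (hdeg v x hvx).trans (cnt_mono fun w hw => ?_)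
    rcases hw with h | h | h
    · exact absurd ⟨hA, h.2.2⟩ (hX v x hvx).2
    · exact h.2.2
    · exact absurd ⟨hA, h.1⟩ (hX v x hvx).1
  have hBOut : ∀ v x, p v x → B v x → (1 / 3 + 2 * δ) * n ≤ cnt (fun w => A v w) := by
    intro v x hvx hBx
    refine (hdeg v x hvx).trans (cnt_mono fun w hw => ?_)
    rcases hw with h | h | h
    · exact h.1
    · exact absurd ⟨h.1, hBx⟩ (hX v x hvx).2
    · exact absurd ⟨h.1, hBx⟩ (hXB v x hvx)
  have hkey : ∀ v, ¬ N v → (∃ u, p u v ∧ A u v) → (∃ x, p v x ∧ (A v x ∨ B v x)) → False := by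
    rintro v hv ⟨u, huv, hAu⟩ ⟨x, hvx, hx⟩
    have hv' : cnt (fun u => ¬ p v u) ≤ δ * n := not_lt.1 hv
    have hlt : cnt (fun u => ¬ p v u) < (1 / 3 + 2 * δ) * n := by nlinarith
    have h1 := hIn u v huv hAu
    have h23 : (1 / 3 + 2 * δ) * n ≤ cnt (fun w => A v w) ∧
        (1 / 3 + 2 * δ) * n ≤ cnt (fun w => B v w) := by
      rcases hx with hx | hx
      · have hb := hOutB v x hvx hx
        obtain ⟨w, hw, hpw⟩ := exists_of_cnt_lt (hlt.trans_le hb)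
        exact ⟨hBOut v w (not_not.1 hpw) hw, hb⟩
      · have ha := hBOut v x hvx hx
        obtain ⟨w, hw, hpw⟩ := exists_of_cnt_lt (hlt.trans_le ha)
        exact ⟨ha, hOutB v w (not_not.1 hpw) hw⟩
    have hsum : cnt (fun w => A w v) + cnt (fun w => A v w) + cnt (fun w => B v w) ≤
        n + 2 * cnt (fun u => ¬ p v u) := by
      classical
      have : n = ∑ _x : V, (1 : ℝ) := by simp [hn]
      rw [this]
      simp only [cnt_eq_sum, mul_sum, ← sum_add_distrib]
      refine sum_le_sum fun w _ => ?_
      by_cases hpw : p v w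
      · have e1 := hX v w hpw
        have e2 := hXB v w hpw
        by_cases a1 : A w v <;> by_cases a2 : A v w <;> by_cases a3 : B v w <;>
          simp_all
      · rw [if_pos hpw]
        split_ifs <;> norm_num
    nlinarith [h23.1, h23.2]
  set S : V → Prop := fun v => ¬ ∃ x, p v x ∧ (A v x ∨ B v x) with hS
  have hnp : ∀ u v, S u → S v → ¬ p u v := by
    intro u v hu hv huv
    have : 0 < cnt (fun w => (A u w ∧ A v w ∧ B u v) ∨ (A u v ∧ A w v ∧ B u w) ∨
        (A v u ∧ A w u ∧ B v w)) := lt_of_lt_of_le (by positivity) (hdeg u v huv)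
    obtain ⟨w, hw, -⟩ := exists_of_cnt_lt (Q := fun _ : V => False)
      (by simpa [cnt] using this)
    rcases hw with h | h | h
    · exact hu ⟨v, huv, Or.inr h.2.2⟩
    · exact hu ⟨v, huv, Or.inl h.1⟩
    · exact hv ⟨u, hp _ _ huv, Or.inl h.1⟩
  have hSN : cnt (fun v => S v ∨ N v) ≤ 2 * (δ * n) := by
    by_cases hex : ∃ v, S v ∧ ¬ N v
    · obtain ⟨v, hv, hvN⟩ := hex
      have h1 : cnt S ≤ cnt (fun u => ¬ p v u) := cnt_mono fun u hu => hnp v u hv hu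
      have h2 : cnt (fun u => ¬ p v u) ≤ δ * n := not_lt.1 hvN
      linarith [cnt_or_le S N]
    · push Not at hex
      have h1 : cnt S ≤ cnt N := cnt_mono hex
      linarith [cnt_or_le S N]
  have htot : cnt (fun _ : V => True) = n := by simp [cnt, hn]
  obtain ⟨u, -, hu⟩ := exists_of_cnt_lt (P := fun _ : V => True) (Q := fun v => S v ∨ N v)
    (by rw [htot]; nlinarith)
  have huN : cnt (fun v => ¬ p u v) ≤ δ * n := not_lt.1 fun h => hu (Or.inr h)
  obtain ⟨v, -, hv⟩ := exists_of_cnt_lt (P := fun _ : V => True)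
    (Q := fun v => (S v ∨ N v) ∨ ¬ p u v)
    (by rw [htot]; nlinarith [cnt_or_le (fun v => S v ∨ N v) (fun v => ¬ p u v)])
  push Not at hv hu
  have huv := hv.2
  obtain ⟨w, hw, hwn⟩ := exists_of_cnt_lt (Q := fun v => (S v ∨ N v) ∨ ¬ p u v)
    (lt_of_lt_of_le (by nlinarith [cnt_or_le (fun v => S v ∨ N v) (fun v => ¬ p u v)])
      (hdeg u v huv))
  push Not at hwn
  rcases hw with h | h | h
  · exact hkey w hwn.1.2 ⟨u, hwn.2, h.1⟩ (not_not.1 hwn.1.1)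
  · exact hkey v hv.1.2 ⟨u, huv, h.1⟩ (not_not.1 hv.1.1)
  · exact hkey u hu.2 ⟨v, hp _ _ huv, h.1⟩ (not_not.1 hu.1)

/-- Two copies of `K₄⁻` sharing the pair `{v, u}`, with apex `v` in one and a base vertex in the
other, carry a closed tight walk of length ten. -/
def apexBaseWalk (j : ℕ) : Fin 6 := ![0, 1, 2, 3, 1, 0, 4, 5, 1, 4] (Fin.ofNat 10 j)

/-- Two copies of `K₄⁻` sharing the pair `{v, u}`, with apex `v` in one and apex `u` in the other,
carry a closed tight walk of length ten. -/
def apexApexWalk (j : ℕ) : Fin 6 := ![1, 0, 2, 1, 3, 0, 1, 4, 0, 5] (Fin.ofNat 10 j)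

lemma ofNat_ten_add (j k : ℕ) : Fin.ofNat 10 (j + k) = Fin.ofNat 10 j + Fin.ofNat 10 k := by
  ext
  simp [Fin.val_add]

lemma apexBaseWalk_add_ten (j : ℕ) : apexBaseWalk (j + 10) = apexBaseWalk j := by
  unfold apexBaseWalk
  rw [ofNat_ten_add, show Fin.ofNat 10 10 = 0 from rfl, add_zero]

lemma apexApexWalk_add_ten (j : ℕ) : apexApexWalk (j + 10) = apexApexWalk j := by
  unfold apexApexWalk
  rw [ofNat_ten_add, show Fin.ofNat 10 10 = 0 from rfl, add_zero]

lemma apexBaseWalk_ne (j : ℕ) : apexBaseWalk j ≠ apexBaseWalk (j + 1) ∧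
    apexBaseWalk (j + 1) ≠ apexBaseWalk (j + 2) ∧ apexBaseWalk j ≠ apexBaseWalk (j + 2) := by
  simp only [apexBaseWalk, ofNat_ten_add]
  generalize Fin.ofNat 10 j = i
  revert i
  decide

lemma apexApexWalk_ne (j : ℕ) : apexApexWalk j ≠ apexApexWalk (j + 1) ∧
    apexApexWalk (j + 1) ≠ apexApexWalk (j + 2) ∧ apexApexWalk j ≠ apexApexWalk (j + 2) := by
  simp only [apexApexWalk, ofNat_ten_add]
  generalize Fin.ofNat 10 j = i
  revert i
  decide

lemma apexBaseWalk_edges {V : Type*} {E : V → V → V → Prop}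
    (hrot : ∀ a b c, E a b c → E b c a) (hswap : ∀ a b c, E a b c → E b a c) {u v a b w c : V}
    (h : E v u a ∧ E v u b ∧ E v a b) (h' : E w u v ∧ E w u c ∧ E w v c) (j : ℕ) :
    E (![u, v, a, b, w, c] (apexBaseWalk j)) (![u, v, a, b, w, c] (apexBaseWalk (j + 1)))
      (![u, v, a, b, w, c] (apexBaseWalk (j + 2))) := by
  simp only [apexBaseWalk, ofNat_ten_add]
  generalize Fin.ofNat 10 j = i
  have hsym : ∀ x y z, E x y z → E x z y ∧ E y x z ∧ E y z x ∧ E z x y ∧ E z y x := by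
    intro x y z hE
    have h1 := hrot _ _ _ hE
    have h2 := hrot _ _ _ h1
    exact ⟨hswap _ _ _ h2, hswap _ _ _ hE, h1, h2, hswap _ _ _ h1⟩
  have := hsym _ _ _ h.1
  have := hsym _ _ _ h.2.1
  have := hsym _ _ _ h.2.2
  have := hsym _ _ _ h'.1
  have := hsym _ _ _ h'.2.1
  have := hsym _ _ _ h'.2.2
  clear hsym hrot hswap
  fin_cases i <;> simp <;> tauto

lemma apexApexWalk_edges {V : Type*} {E : V → V → V → Prop}
    (hrot : ∀ a b c, E a b c → E b c a) (hswap : ∀ a b c, E a b c → E b a c) {u v a b c d : V}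
    (h : E v u a ∧ E v u b ∧ E v a b) (h' : E u v c ∧ E u v d ∧ E u c d) (j : ℕ) :
    E (![u, v, a, b, c, d] (apexApexWalk j)) (![u, v, a, b, c, d] (apexApexWalk (j + 1)))
      (![u, v, a, b, c, d] (apexApexWalk (j + 2))) := by
  simp only [apexApexWalk, ofNat_ten_add]
  generalize Fin.ofNat 10 j = i
  have hsym : ∀ x y z, E x y z → E x z y ∧ E y x z ∧ E y z x ∧ E z x y ∧ E z y x := by
    intro x y z hE
    have h1 := hrot _ _ _ hE
    have h2 := hrot _ _ _ h1
    exact ⟨hswap _ _ _ h2, hswap _ _ _ hE, h1, h2, hswap _ _ _ h1⟩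
  have := hsym _ _ _ h.1
  have := hsym _ _ _ h.2.1
  have := hsym _ _ _ h.2.2
  have := hsym _ _ _ h'.1
  have := hsym _ _ _ h'.2.1
  have := hsym _ _ _ h'.2.2
  clear hsym hrot hswap
  fin_cases i <;> simp <;> tauto

lemma cnt_pairs_mul_le {V : Type} [Fintype V] {X : V → V → Prop} {F G : V → V → V → V → Prop}
    {P : (Fin 6 → V) → Prop} {κ t : ℝ} (ht : 0 ≤ t)
    (hX : κ ≤ cnt (fun x : V × V => X x.1 x.2))
    (hF : ∀ u v, X u v → t ≤ cnt (fun p : V × V => F u v p.1 p.2))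
    (hG : ∀ u v, X u v → t ≤ cnt (fun p : V × V => G u v p.1 p.2))
    (hP : ∀ u v a b c d, F u v a b → G u v c d → P ![u, v, a, b, c, d]) :
    κ * (t * t) ≤ cnt P := by
  refine (mul_le_mul_of_nonneg_right hX (by positivity)).trans ((cnt_mul_le_cnt_prod
    (fun (x : V × V) (y : (V × V) × (V × V)) =>
      F x.1 x.2 y.1.1 y.1.2 ∧ G x.1 x.2 y.2.1 y.2.2) (fun x hx => ?_)).trans ?_)
  · rw [cnt_and_mul (fun p : V × V => F x.1 x.2 p.1 p.2) (fun p : V × V => G x.1 x.2 p.1 p.2)]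
    exact mul_le_mul (hF _ _ hx) (hG _ _ hx) ht (cnt_nonneg _)
  · refine cnt_le_of_injective
      (fun p => ![p.1.1, p.1.2, p.2.1.1, p.2.1.2, p.2.2.1, p.2.2.2]) ?_ ?_
    · rintro ⟨⟨u, v⟩, ⟨a, b⟩, c, d⟩ ⟨⟨u', v'⟩, ⟨a', b'⟩, c', d'⟩ h
      simpa [Matrix.vecCons_inj, and_assoc] using h
    · exact fun p hp => hP _ _ _ _ _ _ hp.1 hp.2

lemma cnt_inconsistent_apex_le {V : Type} [Fintype V] {ap : V → V → V → Prop}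
    {A B : V → V → Prop} {M : ℝ} (hsymm : ∀ w u v, ap w u v → ap w v u)
    (hA : cnt (fun p : (V × V) × V => ap p.1.2 p.1.1 p.2 ∧ ¬ A p.1.1 p.1.2) ≤ M)
    (hB : cnt (fun p : (V × V) × V => ap p.2 p.1.1 p.1.2 ∧ ¬ B p.1.1 p.1.2) ≤ M) :
    cnt (fun p : (V × V) × V =>
      (ap p.2 p.1.1 p.1.2 ∧ ¬ (A p.1.1 p.2 ∧ A p.1.2 p.2 ∧ B p.1.1 p.1.2)) ∨
      (ap p.1.2 p.1.1 p.2 ∧ ¬ (A p.1.1 p.1.2 ∧ A p.2 p.1.2 ∧ B p.1.1 p.2)) ∨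
      (ap p.1.1 p.1.2 p.2 ∧ ¬ (A p.1.2 p.1.1 ∧ A p.2 p.1.1 ∧ B p.1.2 p.2))) ≤ 9 * M := by
  have hinj1 : Function.Injective (fun q : V × V × V => ((q.2.1, q.1), q.2.2)) := by
    rintro ⟨a, b, c⟩ ⟨a', b', c'⟩ h
    simp_all
  have hinj2 : Function.Injective (fun q : V × V × V => ((q.2.2, q.1), q.2.1)) := by
    rintro ⟨a, b, c⟩ ⟨a', b', c'⟩ h
    simp_all
  have hinj3 : Function.Injective (fun q : V × V × V => ((q.2.1, q.2.2), q.1)) := by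
    rintro ⟨a, b, c⟩ ⟨a', b', c'⟩ h
    simp_all
  have hone : cnt (fun q : V × V × V => ap q.1 q.2.1 q.2.2 ∧
      ¬ (A q.2.1 q.1 ∧ A q.2.2 q.1 ∧ B q.2.1 q.2.2)) ≤ 3 * M := by
    have g1 := (cnt_le_of_injective (P := fun q : V × V × V => ap q.1 q.2.1 q.2.2 ∧ ¬ A q.2.1 q.1)
      _ hinj1 (fun _ h => h)).trans hA
    have g2 := (cnt_le_of_injective (P := fun q : V × V × V => ap q.1 q.2.2 q.2.1 ∧ ¬ A q.2.2 q.1)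
      _ hinj2 (fun _ h => h)).trans hA
    have g3 := (cnt_le_of_injective
      (P := fun q : V × V × V => ap q.1 q.2.1 q.2.2 ∧ ¬ B q.2.1 q.2.2)
      _ hinj3 (fun _ h => h)).trans hB
    refine le_trans (cnt_mono fun q hq => ?_) ((cnt_or_le _ _).trans
      ((add_le_add g1 ((cnt_or_le _ _).trans (add_le_add g2 g3))).trans (le_of_eq (by ring))))
    have := hsymm _ _ _ hq.1
    tauto
  have hperm : ∀ f : (V × V) × V → V × V × V, Function.Injective f →
      cnt (fun p => ap (f p).1 (f p).2.1 (f p).2.2 ∧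
        ¬ (A (f p).2.1 (f p).1 ∧ A (f p).2.2 (f p).1 ∧ B (f p).2.1 (f p).2.2)) ≤ 3 * M :=
    fun f hf => (cnt_le_of_injective f hf fun _ h => h).trans hone
  have g1 := hperm (fun p => (p.2, p.1.1, p.1.2)) (by
    rintro ⟨⟨a, b⟩, c⟩ ⟨⟨a', b'⟩, c'⟩ h
    simp_all)
  have g2 := hperm (fun p => (p.1.2, p.1.1, p.2)) (by
    rintro ⟨⟨a, b⟩, c⟩ ⟨⟨a', b'⟩, c'⟩ h
    simp_all)
  have g3 := hperm (fun p => (p.1.1, p.1.2, p.2)) (by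
    rintro ⟨⟨a, b⟩, c⟩ ⟨⟨a', b'⟩, c'⟩ h
    simp_all)
  exact (cnt_or_le _ _).trans
    ((add_le_add g1 ((cnt_or_le _ _).trans (add_le_add g2 g3))).trans (le_of_eq (by ring)))

/-- Supersaturation: a 3-graph with minimum codegree above `(1/3 + ε) n` contains a positive
density of one of the two configurations that carry a closed tight walk of length ten. -/
lemma supersaturation {V : Type} [Fintype V] [Nonempty V] {E : V → V → V → Prop}
    (hrot : ∀ a b c, E a b c → E b c a) (hswap : ∀ a b c, E a b c → E b a c)
    (hne : ∀ a b c, E a b c → a ≠ c ∧ b ≠ c) {δ : ℝ} (hδ : 0 < δ) (hδ' : δ ≤ 1 / 100)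
    (hdeg : ∀ u v, u ≠ v → (1 / 3 + 10 * δ) * Fintype.card V ≤ cnt (E u v))
    (hbig : 4 ≤ δ ^ 2 * Fintype.card V) :
    ∃ s ∈ ({apexBaseWalk, apexApexWalk} : Set (ℕ → Fin 6)),
      δ ^ 2 / 12 * (10 * δ * (δ ^ 3 / 36)) ^ 2 * (Fintype.card V : ℝ) ^ 6 ≤
      cnt (fun z : Fin 6 → V => ∀ j, E (z (s j)) (z (s (j + 1))) (z (s (j + 2)))) := by
  set n : ℝ := (Fintype.card V : ℝ) with hn
  have hn0 : 0 < n := by rw [hn]; exact_mod_cast Fintype.card_pos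
  set ε := 10 * δ with hε
  set τ := δ ^ 3 / 36 with hτ
  have hτ0 : 0 < τ := by positivity
  have hε0 : 0 < ε := by positivity
  have hE : ∀ {a b c}, E a b c → E a c b := fun h => hswap _ _ _ (hrot _ _ _ (hrot _ _ _ h))
  set A : V → V → Prop := fun u v =>
    ε * τ * n ^ 2 ≤ cnt (fun p : V × V => E v u p.1 ∧ E v u p.2 ∧ E v p.1 p.2) with hA
  set B : V → V → Prop := fun u v =>
    ε * τ * n ^ 2 ≤ cnt (fun p : V × V => E p.1 u v ∧ E p.1 u p.2 ∧ E p.1 v p.2) with hBdef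
  have hB : ∀ u v, B u v → B v u := fun u v h =>
    h.trans (cnt_mono fun p hp => ⟨hE hp.1, hp.2.2, hp.2.1⟩)
  by_contra hcon
  have hAB : cnt (fun x : V × V => A x.1 x.2 ∧ B x.1 x.2) ≤ δ ^ 2 / 12 * n ^ 2 := by
    by_contra! hlt
    refine hcon ⟨apexBaseWalk, by simp, ?_⟩
    refine le_trans (le_of_eq ?_) (cnt_pairs_mul_le (t := ε * τ * n ^ 2)
      (X := fun u v => A u v ∧ B u v) (F := fun u v a b => E v u a ∧ E v u b ∧ E v a b)
      (G := fun u v w c => E w u v ∧ E w u c ∧ E w v c) (by positivity) hlt.le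
      (fun u v h => h.1) (fun u v h => h.2) ?_)
    · ring
    · exact fun u v a b c d h h' j => apexBaseWalk_edges hrot hswap h h' j
  have hAA : cnt (fun x : V × V => A x.1 x.2 ∧ A x.2 x.1) ≤ δ ^ 2 / 12 * n ^ 2 := by
    by_contra! hlt
    refine hcon ⟨apexApexWalk, by simp, ?_⟩
    refine le_trans (le_of_eq ?_) (cnt_pairs_mul_le (t := ε * τ * n ^ 2)
      (X := fun u v => A u v ∧ A v u) (F := fun u v a b => E v u a ∧ E v u b ∧ E v a b)
      (G := fun u v a b => E u v a ∧ E u v b ∧ E u a b) (by positivity) hlt.le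
      (fun u v h => h.1) (fun u v h => h.2) ?_)
    · ring
    · exact fun u v a b c d h h' j => apexApexWalk_edges hrot hswap h h' j
  have hBA : cnt (fun x : V × V => A x.2 x.1 ∧ B x.1 x.2) ≤ δ ^ 2 / 12 * n ^ 2 :=
    (cnt_le_of_injective Prod.swap Prod.swap_injective
      fun x hx => ⟨hx.1, hB _ _ hx.2⟩).trans hAB
  -- `ap w u v`: the edge `uvw` lies in many copies of `K₄⁻` with apex `w`
  set ap : V → V → V → Prop := fun w u v =>
    E u v w ∧ ε * n ≤ cnt (fun x => E w u x ∧ E w v x) with hap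
  have hap_symm : ∀ w u v, ap w u v → ap w v u := fun w u v h =>
    ⟨hswap _ _ _ h.1, h.2.trans (cnt_mono fun x hx => ⟨hx.2, hx.1⟩)⟩
  have hap_exists : ∀ u v w, E u v w → u ≠ v → u ≠ w → v ≠ w →
      ap w u v ∨ ap v u w ∨ ap u v w := by
    intro u v w h huv huw hvw
    by_contra! hc
    simp only [hap, not_and, not_le] at hc
    have h1 := hc.1 h
    have h2 := hc.2.1 (hE h)
    have h3 := hc.2.2 (hrot _ _ _ h)
    have d1 := hdeg u v huv
    have d2 := hdeg u w huw
    have d3 := hdeg v w hvw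
    have hsum : cnt (E u v) + cnt (E u w) + cnt (E v w) ≤
        n + (cnt (fun x => E w u x ∧ E w v x) + cnt (fun x => E v u x ∧ E v w x) +
          cnt (fun x => E u v x ∧ E u w x)) := by
      classical
      have : n = ∑ _x : V, (1 : ℝ) := by simp [hn]
      rw [this]
      simp only [cnt_eq_sum, ← sum_add_distrib]
      refine sum_le_sum fun x _ => ?_
      have e1 : E v u x ↔ E u v x := ⟨hswap _ _ _, hswap _ _ _⟩
      have e2 : E w u x ↔ E u w x := ⟨hswap _ _ _, hswap _ _ _⟩
      have e3 : E w v x ↔ E v w x := ⟨hswap _ _ _, hswap _ _ _⟩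
      rw [e1, e2, e3]
      by_cases a1 : E u v x <;> by_cases a2 : E u w x <;> by_cases a3 : E v w x <;>
        simp [a1, a2, a3]
    nlinarith
  have hfewA : cnt (fun p : (V × V) × V => ap p.1.2 p.1.1 p.2 ∧ ¬ A p.1.1 p.1.2) ≤
      n ^ 2 * (τ * n) := by
    refine (cnt_prod_le (fun (x : V × V) v => ap x.2 x.1 v ∧ ¬ A x.1 x.2) (t := τ * n)
      fun x => ?_).trans (le_of_eq (by simp [hn, sq]))
    by_cases hx : A x.1 x.2
    · simp only [hx, not_true_eq_false, and_false]
      simp [cnt]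
      positivity
    · have := cnt_mul_le_cnt_prod (fun v y => E x.2 x.1 v ∧ E x.2 x.1 y ∧ E x.2 v y)
        (Q := fun v => ap x.2 x.1 v ∧ ¬ A x.1 x.2) (t := ε * n)
        (fun v hv => hv.1.2.trans (cnt_mono fun y hy => ⟨hrot _ _ _ (hrot _ _ _ hv.1.1), hy⟩))
      refine le_of_mul_le_mul_right (this.trans ?_) (mul_pos hε0 hn0)
      exact (not_le.1 hx).le.trans (le_of_eq (by ring))
  have hfewB : cnt (fun p : (V × V) × V => ap p.2 p.1.1 p.1.2 ∧ ¬ B p.1.1 p.1.2) ≤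
      n ^ 2 * (τ * n) := by
    refine (cnt_prod_le (fun (x : V × V) w => ap w x.1 x.2 ∧ ¬ B x.1 x.2) (t := τ * n)
      fun x => ?_).trans (le_of_eq (by simp [hn, sq]))
    by_cases hx : B x.1 x.2
    · simp only [hx, not_true_eq_false, and_false]
      simp [cnt]
      positivity
    · have := cnt_mul_le_cnt_prod (fun w y => E w x.1 x.2 ∧ E w x.1 y ∧ E w x.2 y)
        (Q := fun w => ap w x.1 x.2 ∧ ¬ B x.1 x.2) (t := ε * n)
        (fun w hw => hw.1.2.trans (cnt_mono fun y hy => ⟨hrot _ _ _ (hrot _ _ _ hw.1.1), hy⟩))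
      refine le_of_mul_le_mul_right (this.trans ?_) (mul_pos hε0 hn0)
      exact (not_le.1 hx).le.trans (le_of_eq (by ring))
  set T : V → V → V → Prop := fun u v w => (A u w ∧ A v w ∧ B u v) ∨ (A u v ∧ A w v ∧ B u w) ∨
    (A v u ∧ A w u ∧ B v w) with hT
  have hTsymm : ∀ u v w, T u v w → T v u w := by
    rintro u v w (h | h | h)
    · exact Or.inl ⟨h.2.1, h.1, hB _ _ h.2.2⟩
    · exact Or.inr (Or.inr h)
    · exact Or.inr (Or.inl h)
  set U : V → V → V → Prop := fun u v w =>
    (E u v w ∧ u ≠ v ∧ u ≠ w ∧ v ≠ w) ∧ ¬ T u v w with hU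
  have hUc : cnt (fun p : (V × V) × V => U p.1.1 p.1.2 p.2) ≤ 9 * (n ^ 2 * (τ * n)) := by
    refine le_trans (cnt_mono fun p hp => ?_) (cnt_inconsistent_apex_le hap_symm hfewA hfewB)
    obtain ⟨⟨h, h1, h2, h3⟩, hnT⟩ := hp
    simp only [hT, not_or] at hnT
    rcases hap_exists _ _ _ h h1 h2 h3 with ha | ha | ha
    · exact Or.inl ⟨ha, hnT.1⟩
    · exact Or.inr (Or.inl ⟨ha, hnT.2.1⟩)
    · exact Or.inr (Or.inr ⟨ha, hnT.2.2⟩)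
  set X : V → V → Prop := fun u v => (A u v ∧ A v u) ∨ (A u v ∧ B u v) ∨ (A v u ∧ B u v) with hXdef
  set p : V → V → Prop := fun u v => u ≠ v ∧ ¬ X u v ∧ cnt (U u v) ≤ δ * n with hp
  have hXc : cnt (fun x : V × V => X x.1 x.2) ≤ 3 * (δ ^ 2 / 12 * n ^ 2) :=
    (cnt_or_le _ _).trans ((add_le_add hAA ((cnt_or_le _ _).trans (add_le_add hAB hBA))).trans
      (le_of_eq (by ring)))
  have hQ : cnt (fun x : V × V => δ * n < cnt (U x.1 x.2)) ≤ δ ^ 2 / 4 * n ^ 2 := by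
    have := cnt_mul_le_cnt_prod (fun x : V × V => U x.1 x.2)
      (Q := fun x : V × V => δ * n < cnt (U x.1 x.2)) (t := δ * n) (fun x hx => hx.le)
    refine le_of_mul_le_mul_right (this.trans (hUc.trans (le_of_eq ?_))) (mul_pos hδ hn0)
    rw [hτ]
    ring
  have hdiag : cnt (fun x : V × V => x.1 = x.2) ≤ δ ^ 2 / 4 * n ^ 2 := by
    refine (cnt_prod_le (fun u v : V => u = v) (t := 1) fun u => ?_).trans ?_
    · classical
      simp [cnt, filter_eq]
    · nlinarith
  refine false_of_nice_pairs (A := A) (B := B) (p := p) hδ hδ' hB ?_ ?_ ?_ ?_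
  · rintro u v ⟨h1, h2, h3⟩
    refine ⟨h1.symm, fun h => h2 ?_, le_trans (cnt_mono fun w hw => ?_) h3⟩
    · rcases h with h | h | h
      · exact Or.inl h.symm
      · exact Or.inr (Or.inr ⟨h.1, hB _ _ h.2⟩)
      · exact Or.inr (Or.inl ⟨h.1, hB _ _ h.2⟩)
    · exact ⟨⟨hswap _ _ _ hw.1.1, hw.1.2.1.symm, hw.1.2.2.2, hw.1.2.2.1⟩,
        fun h => hw.2 (hTsymm _ _ _ h)⟩
  · refine (cnt_mono (Q := fun x : V × V =>
      x.1 = x.2 ∨ X x.1 x.2 ∨ δ * n < cnt (U x.1 x.2)) fun x hx => ?_).trans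
      ((cnt_or_le _ _).trans ((add_le_add hdiag ((cnt_or_le _ _).trans
        (add_le_add hXc hQ))).trans ?_))
    · by_contra hc
      push Not at hc
      exact hx ⟨hc.1, hc.2.1, hc.2.2⟩
    · nlinarith [mul_pos (pow_pos hδ 2) (pow_pos hn0 2)]
  · rintro u v ⟨-, h, -⟩
    exact ⟨fun h' => h (Or.inl h'), fun h' => h (Or.inr (Or.inl h'))⟩
  · rintro u v ⟨huv, -, hUuv⟩
    have h1 : cnt (E u v) ≤ cnt (T u v) + cnt (U u v) := by
      refine le_trans (cnt_mono fun w hw => ?_) (cnt_or_le _ _)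
      by_cases hTw : T u v w
      · exact Or.inl hTw
      · refine Or.inr ⟨⟨hw, huv, ?_, ?_⟩, hTw⟩
        · exact (hne _ _ _ hw).1
        · exact (hne _ _ _ hw).2
    have h2 := hdeg u v huv
    have h3 : (1 / 3 + 2 * δ) * n ≤ cnt (T u v) := by nlinarith
    exact h3

lemma ne_of_card_eq_three {V : Type*} [DecidableEq V] {a b c : V}
    (h : ({a, b, c} : Finset V).card = 3) : a ≠ b ∧ a ≠ c ∧ b ≠ c := by
  have key : ∀ x y : V, ({x, y} : Finset V).card ≠ 3 := fun x y => by
    have := card_le_two (a := x) (b := y)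
    omega
  refine ⟨?_, ?_, ?_⟩ <;> rintro rfl
  · exact key a c (by simpa using h)
  · exact key a b (by simpa [pair_comm b a] using h)
  · exact key a b (by simpa using h)

lemma hasTightCycle_of_le_minCodeg {n m q : ℕ} {H : Finset (Finset (Fin n))}
    (hH : IsUniform3 H) {δ : ℝ} (hδ : 0 < δ) (hδ' : δ ≤ 1 / 100) (hm : 1 ≤ m)
    (hn : 4 ≤ δ ^ 2 * n)
    (hbig : ((6 * (10 * m + 3 * q) : ℕ) : ℝ) ^ 2 <
      (δ ^ 2 / 12 * (10 * δ * (δ ^ 3 / 36)) ^ 2) ^ ((10 * m + 3 * q) ^ 6) * n)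
    (hmin : (1 / 3 + 10 * δ) * n ≤ minCodeg H) : HasTightCycle (10 * m + 3 * q) H := by
  have hn0 : n ≠ 0 := by
    rintro rfl
    norm_num at hn
  have : NeZero n := ⟨hn0⟩
  set E : Fin n → Fin n → Fin n → Prop := fun a b c => ({a, b, c} : Finset (Fin n)) ∈ H with hE
  have hrot : ∀ a b c, E a b c → E b c a := fun a b c h => by
    have : ({b, c, a} : Finset (Fin n)) = {a, b, c} := by ext x; simp; tauto
    simpa only [hE, this] using h
  have hswap : ∀ a b c, E a b c → E b a c := fun a b c h => by
    have : ({b, a, c} : Finset (Fin n)) = {a, b, c} := by ext x; simp; tauto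
    simpa only [hE, this] using h
  have hne : ∀ a b c, E a b c → a ≠ c ∧ b ≠ c := fun a b c h =>
    (ne_of_card_eq_three (hH _ h)).2
  have hdeg : ∀ u v, u ≠ v → (1 / 3 + 10 * δ) * Fintype.card (Fin n) ≤ cnt (E u v) := by
    intro u v huv
    have h1 : minCodeg H ≤ codeg H u v := Nat.sInf_le ⟨u, v, huv, rfl⟩
    have h2 : cnt (E u v) = codeg H u v := by
      rw [cnt, codeg, Set.ncard_eq_toFinset_card', Set.toFinset_ofFinset]
      simp only [hE]
      congr!
    rw [h2, Fintype.card_fin]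
    exact hmin.trans (by exact_mod_cast h1)
  obtain ⟨s, hs, hcount⟩ := supersaturation hrot hswap hne hδ hδ' hdeg (by simpa using hn)
  have hwalk : (∀ j, s (j + 10) = s j) ∧
      ∀ j, s j ≠ s (j + 1) ∧ s (j + 1) ≠ s (j + 2) ∧ s j ≠ s (j + 2) := by
    rcases hs with rfl | rfl
    · exact ⟨apexBaseWalk_add_ten, apexBaseWalk_ne⟩
    · exact ⟨apexApexWalk_add_ten, apexApexWalk_ne⟩
  obtain ⟨y, hinj, hy⟩ := exists_injective_closed_walk hrot hwalk.1 hwalk.2 m q hm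
    (by positivity) hcount (by simpa using hbig)
  have hl : 10 ≤ 10 * m + 3 * q := by omega
  generalize 10 * m + 3 * q = ℓ at hinj hy hl
  have : NeZero ℓ := ⟨by omega⟩
  have : Fact (1 < ℓ) := ⟨by omega⟩
  refine ⟨fun i => y i.val, fun i j hij => ZMod.val_injective ℓ
    (hinj (ZMod.val_lt i) (ZMod.val_lt j) hij), fun i => ?_⟩
  obtain ⟨j, rfl⟩ : ∃ j, i = j + 1 := ⟨i - 1, by ring⟩
  have h := hy j.val (ZMod.val_lt j)
  have e1 : (j + 1).val = (j.val + 1) % ℓ := by rw [ZMod.val_add, ZMod.val_one]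
  have e2 : (j + 1 + 1).val = (j.val + 2) % ℓ := by
    rw [ZMod.val_add, e1, ZMod.val_one, Nat.mod_add_mod]
  rw [← e1, ← e2] at h
  simpa [hE] using h

/-- The triples of `Fin n` whose sum is `1` modulo `3`. -/
def sumOneTriples (n : ℕ) : Finset (Finset (Fin n)) :=
  univ.filter fun e => e.card = 3 ∧ (∑ x ∈ e, x.val) % 3 = 1

lemma isUniform3_sumOneTriples (n : ℕ) : IsUniform3 (sumOneTriples n) := fun e he => by
  simp only [sumOneTriples, mem_filter] at he
  exact he.2.1

lemma sum_triple_mod {n : ℕ} {a b c : Fin n} (h : {a, b, c} ∈ sumOneTriples n) :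
    (a.val + b.val + c.val) % 3 = 1 := by
  simp only [sumOneTriples, mem_filter] at h
  obtain ⟨-, h3, hs⟩ := h
  obtain ⟨h1, h2, h3⟩ := ne_of_card_eq_three h3
  rw [sum_insert (by simp [h1, h2]), sum_insert (by simp [h3]), sum_singleton] at hs
  omega

lemma not_hasTightCycle_sumOneTriples {ℓ : ℕ} (hℓ : ¬ 3 ∣ ℓ) (n : ℕ) :
    ¬ HasTightCycle ℓ (sumOneTriples n) := by
  rintro ⟨x, -, hx⟩
  set f : ZMod ℓ → ZMod 3 := fun i => ((x i).val : ZMod 3) with hf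
  have hsum : ∀ i, f (i - 1) + f i + f (i + 1) = 1 := fun i => by
    have h := sum_triple_mod (hx i)
    have h' : (((x (i - 1)).val + (x i).val + (x (i + 1)).val : ℕ) : ZMod 3) = (1 : ℕ) :=
      (ZMod.natCast_eq_natCast_iff' _ _ 3).2 h
    push_cast at h'
    exact h'
  have hthree : ∀ i, f (i + 3) = f i := fun i => by
    have h1 := hsum (i + 1)
    have h2 := hsum (i + 2)
    rw [show i + 1 - 1 = i by ring, show i + 1 + 1 = i + 2 by ring] at h1
    rw [show i + 2 - 1 = i + 1 by ring, show i + 2 + 1 = i + 3 by ring] at h2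
    linear_combination h2 - h1
  have hmul : ∀ (k : ℕ) i, f (i + 3 * k) = f i := fun k => by
    induction k with
    | zero => simp
    | succ k ih =>
      intro i
      rw [← ih i, ← hthree (i + 3 * k)]
      push_cast
      ring_nf
  have hcop : Nat.Coprime 3 ℓ := (Nat.Prime.coprime_iff_not_dvd Nat.prime_three).2 hℓ
  have : NeZero ℓ := ⟨by rintro rfl; simp at hℓ⟩
  have hone : ∀ i, f (i + 1) = f i := fun i => by
    have h := hmul ((3 : ZMod ℓ)⁻¹).val i
    have h3 := ZMod.coe_mul_inv_eq_one 3 hcop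
    push_cast at h3
    rwa [ZMod.natCast_zmod_val, h3] at h
  have h := hsum (0 + 1)
  rw [hone (0 + 1), hone 0, show (0 : ZMod ℓ) + 1 - 1 = 0 by ring] at h
  revert h
  generalize f 0 = a
  revert a
  decide

lemma div_three_sub_le_minCodeg_sumOneTriples {n : ℕ} (hn : 2 ≤ n) :
    n / 3 - 2 ≤ minCodeg (sumOneTriples n) := by
  refine le_csInf ⟨_, ⟨0, by omega⟩, ⟨1, by omega⟩, by simp, rfl⟩ ?_
  rintro _ ⟨u, v, huv, rfl⟩
  set r := (1 + 2 * (u.val + v.val)) % 3 with hr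
  let g : Fin (n / 3) → Fin n := fun j => ⟨3 * j.val + r, by have := j.isLt; omega⟩
  have hg : Function.Injective g := fun i j hij => by
    simp only [g, Fin.mk.injEq] at hij
    exact Fin.ext (by omega)
  have hsub : ((univ.image g \ {u, v} : Finset (Fin n)) : Set (Fin n)) ⊆
      {w | {u, v, w} ∈ sumOneTriples n} := by
    intro w hw
    simp only [coe_sdiff, Set.mem_sdiff, coe_image, coe_univ, Set.image_univ, Set.mem_range,
      coe_insert, coe_singleton, Set.mem_insert_iff, Set.mem_singleton_iff, not_or] at hw
    obtain ⟨⟨j, rfl⟩, hju, hjv⟩ := hw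
    have hu : u ∉ ({v, g j} : Finset (Fin n)) := by simp [huv, Ne.symm hju]
    have hv : v ∉ ({g j} : Finset (Fin n)) := by simp [Ne.symm hjv]
    simp only [Set.mem_ofPred_eq, sumOneTriples, mem_filter, mem_univ, true_and]
    rw [card_insert_of_notMem hu, card_insert_of_notMem hv, sum_insert hu, sum_insert hv]
    simp only [card_singleton, sum_singleton, g, true_and]
    omega
  have h1 := Set.ncard_le_ncard hsub (Set.toFinite _)
  rw [Set.ncard_coe_finset] at h1
  have h2 := le_card_sdiff ({u, v} : Finset (Fin n)) (univ.image g)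
  rw [card_image_of_injective _ hg, card_univ, Fintype.card_fin, card_pair huv] at h2
  exact h2.trans h1

lemma minCodeg_le {n : ℕ} (hn : 2 ≤ n) (H : Finset (Finset (Fin n))) : minCodeg H ≤ n := by
  have h : minCodeg H ≤ codeg H ⟨0, by omega⟩ ⟨1, by omega⟩ :=
    Nat.sInf_le ⟨_, _, by simp, rfl⟩
  refine h.trans ((Set.ncard_le_ncard (Set.subset_univ _) (Set.toFinite _)).trans ?_)
  simp [Set.ncard_univ]

lemma bddAbove_minCodeg (ℓ : ℕ) {n : ℕ} (hn : 2 ≤ n) :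
    BddAbove {k : ℕ | ∃ H : Finset (Finset (Fin n)),
      IsUniform3 H ∧ ¬ HasTightCycle ℓ H ∧ minCodeg H = k} := by
  refine ⟨n, ?_⟩
  rintro _ ⟨H, -, -, rfl⟩
  exact minCodeg_le hn H

lemma div_three_sub_le_exCodeg {ℓ n : ℕ} (hℓ : ¬ 3 ∣ ℓ) (hn : 2 ≤ n) :
    n / 3 - 2 ≤ exCodeg ℓ n :=
  (div_three_sub_le_minCodeg_sumOneTriples hn).trans <| le_csSup (bddAbove_minCodeg ℓ hn)
    ⟨_, isUniform3_sumOneTriples n, not_hasTightCycle_sumOneTriples hℓ n, rfl⟩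

lemma exists_minCodeg_eq_exCodeg {ℓ n : ℕ} (hℓ : ¬ 3 ∣ ℓ) (hn : 2 ≤ n) :
    ∃ H : Finset (Finset (Fin n)),
      IsUniform3 H ∧ ¬ HasTightCycle ℓ H ∧ minCodeg H = exCodeg ℓ n :=
  Nat.sSup_mem (s := {k : ℕ | ∃ H : Finset (Finset (Fin n)),
      IsUniform3 H ∧ ¬ HasTightCycle ℓ H ∧ minCodeg H = k})
    ⟨_, _, isUniform3_sumOneTriples n, not_hasTightCycle_sumOneTriples hℓ n, rfl⟩
    (bddAbove_minCodeg ℓ hn)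

lemma eventually_exCodeg_lt {m q : ℕ} (hm : 1 ≤ m) (h3 : ¬ 3 ∣ 10 * m + 3 * q) {δ : ℝ}
    (hδ : 0 < δ) (hδ' : δ ≤ 1 / 100) :
    ∀ᶠ n : ℕ in Filter.atTop, (exCodeg (10 * m + 3 * q) n : ℝ) < (1 / 3 + 10 * δ) * n := by
  have hlarge : ∀ a b : ℝ, 0 < a → ∀ᶠ n : ℕ in Filter.atTop, b < a * n := fun a b ha =>
    (tendsto_natCast_atTop_atTop.const_mul_atTop ha).eventually_gt_atTop b
  filter_upwards [hlarge (δ ^ 2) 4 (by positivity), Filter.eventually_ge_atTop 2,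
    hlarge ((δ ^ 2 / 12 * (10 * δ * (δ ^ 3 / 36)) ^ 2) ^ ((10 * m + 3 * q) ^ 6))
      (((6 * (10 * m + 3 * q) : ℕ) : ℝ) ^ 2) (by positivity)] with n h1 hn h2
  obtain ⟨H, hH, hcyc, hmin⟩ := exists_minCodeg_eq_exCodeg h3 hn
  rw [← hmin]
  by_contra! h
  exact hcyc (hasTightCycle_of_le_minCodeg hH hδ hδ' hm h1.le h2 h)

lemma tendsto_exCodeg_div {m q : ℕ} (hm : 1 ≤ m) (h3 : ¬ 3 ∣ 10 * m + 3 * q) :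
    Filter.Tendsto (fun n : ℕ => (exCodeg (10 * m + 3 * q) n : ℝ) / n) Filter.atTop
      (nhds (1 / 3)) := by
  rw [tendsto_order]
  constructor
  · intro a ha
    filter_upwards [(tendsto_natCast_atTop_atTop.const_mul_atTop
      (sub_pos.2 ha)).eventually_gt_atTop (3 : ℝ), Filter.eventually_ge_atTop 2] with n h hn
    rw [lt_div_iff₀ (by positivity)]
    have h1 := div_three_sub_le_exCodeg h3 hn
    have h2 : n ≤ 3 * exCodeg (10 * m + 3 * q) n + 8 := by omega
    have h2' : (n : ℝ) ≤ 3 * exCodeg (10 * m + 3 * q) n + 8 := by exact_mod_cast h2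
    nlinarith
  · intro a ha
    have hδ : 0 < min (1 / 100) ((a - 1 / 3) / 10) :=
      lt_min (by norm_num) (by linarith)
    filter_upwards [eventually_exCodeg_lt hm h3 hδ (min_le_left _ _),
      Filter.eventually_ge_atTop 1] with n h hn
    have hn' : (0 : ℝ) < n := by exact_mod_cast hn
    rw [div_lt_iff₀ hn']
    refine h.trans_le (mul_le_mul_of_nonneg_right ?_ hn'.le)
    linarith [min_le_right (1 / 100) ((a - 1 / 3) / 10)]

/-- For every `ℓ ∈ {10, 13, 16}` and every `ℓ ≥ 19` not divisible by 3, the codegree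
Turán density of the tight cycle `C_ℓ` equals `1/3`. -/
theorem codegree_turan_density_PSS (ℓ : ℕ)
    (hℓ : ℓ = 10 ∨ ℓ = 13 ∨ ℓ = 16 ∨ (19 ≤ ℓ ∧ ¬ (3 ∣ ℓ))) :
    Filter.Tendsto (fun n : ℕ => (exCodeg ℓ n : ℝ) / n) Filter.atTop (nhds (1 / 3)) := by
  obtain ⟨m, q, hm, rfl⟩ : ∃ m q, 1 ≤ m ∧ ℓ = 10 * m + 3 * q := by
    rcases Nat.lt_or_ge (ℓ % 3) 2 with h | h
    · exact ⟨1, (ℓ - 10) / 3, le_rfl, by omega⟩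
    · exact ⟨2, (ℓ - 20) / 3, by norm_num, by omega⟩
  exact tendsto_exCodeg_div hm (by omega)
end
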